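/- For any point placement P of n points, the sum over all 3-element subsets T of P of the number of 2-element subsets {x, y} ⊆ P \ T such that x and y are both β-points of T lying in distinct regions with respect to T equals T₂(P). -/

import Mathlib

open Finset

/-- A finite set of points in the plane is in *general position* if no three of
its points are collinear. -/
def GenPos (P : Finset (ℝ × ℝ)) : Prop :=
  ∀ x ∈ P, ∀ y ∈ P, ∀ z ∈ P, x ≠ y → x ≠ z → y ≠ z →
    ¬ Collinear ℝ ({x, y, z} : Set (ℝ × ℝ))

/-- A finite set of points is in *convex position* if every point of it is an
extreme point of its convex hull. -/
def ConvexPos (S : Finset (ℝ × ℝ)) : Prop :=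
  ∀ x ∈ S, x ∈ Set.extremePoints ℝ (convexHull ℝ (S : Set (ℝ × ℝ)))

open scoped Classical in
/-- Number of `k`-element subsets of `P` that are in convex position. -/
noncomputable def convexPosCount (P : Finset (ℝ × ℝ)) (k : ℕ) : ℕ :=
  ((P.powersetCard k).filter fun S => ConvexPos S).card

/-- `mu k n` is the minimum number of `k`-element subsets in convex position over
all placements of `n` points in general position. -/
noncomputable def mu (k n : ℕ) : ℕ :=
  sInf {m | ∃ P : Finset (ℝ × ℝ), GenPos P ∧ P.card = n ∧ convexPosCount P k = m}

/-- `x` is a γ-point of `T` if `T ∪ {x}` is in convex position. -/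
def IsGammaPt (T : Finset (ℝ × ℝ)) (x : ℝ × ℝ) : Prop :=
  ConvexPos (insert x T)

/-- `x` is a β-point of `T` if `T ∪ {x}` is not in convex position and `x` does not
lie in the convex hull of `T`. -/
def IsBetaPt (T : Finset (ℝ × ℝ)) (x : ℝ × ℝ) : Prop :=
  ¬ ConvexPos (insert x T) ∧ x ∉ convexHull ℝ (T : Set (ℝ × ℝ))

open scoped Classical in
/-- `γ_T`: number of γ-points of `T` among the points of `P \ T`. -/
noncomputable def gammaCount (P T : Finset (ℝ × ℝ)) : ℕ :=
  ((P \ T).filter fun x => IsGammaPt T x).card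

open scoped Classical in
/-- `β_T`: number of β-points of `T` among the points of `P \ T`. -/
noncomputable def betaCount (P T : Finset (ℝ × ℝ)) : ℕ :=
  ((P \ T).filter fun x => IsBetaPt T x).card

open scoped Classical in
/-- Number of `k`-element subsets of `P` whose convex hull has exactly `j`
extreme points. -/
noncomputable def hullCount (P : Finset (ℝ × ℝ)) (k j : ℕ) : ℕ :=
  ((P.powersetCard k).filter fun S =>
    (Set.extremePoints ℝ (convexHull ℝ (S : Set (ℝ × ℝ)))).ncard = j).card

/-- `x` and `y` lie strictly on the same side of the line through `p` and `q`. -/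
def SameSide (p q x y : ℝ × ℝ) : Prop :=
  0 < ((q.1 - p.1) * (x.2 - p.2) - (q.2 - p.2) * (x.1 - p.1)) *
      ((q.1 - p.1) * (y.2 - p.2) - (q.2 - p.2) * (y.1 - p.1))

/-- `x` and `y` lie in the same region with respect to `T`: for each pair of
distinct points of `T`, they lie strictly on the same side of the line through them. -/
def SameRegion (T : Finset (ℝ × ℝ)) (x y : ℝ × ℝ) : Prop :=
  ∀ p ∈ T, ∀ q ∈ T, p ≠ q → SameSide p q x y

open scoped Classical in
/-- Number of 2-element subsets `{x, y}` of `P \ T` such that `x` and `y` are both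
γ-points of `T` lying in the same region with respect to `T`. -/
noncomputable def gammaSamePairs (P T : Finset (ℝ × ℝ)) : ℕ :=
  (((P \ T).powersetCard 2).filter fun S =>
    (∀ x ∈ S, IsGammaPt T x) ∧ ∀ x ∈ S, ∀ y ∈ S, x ≠ y → SameRegion T x y).card

open scoped Classical in
/-- Number of 2-element subsets `{x, y}` of `P \ T` such that `x` and `y` are both
γ-points of `T` lying in distinct regions with respect to `T`. -/
noncomputable def gammaDiffPairs (P T : Finset (ℝ × ℝ)) : ℕ :=
  (((P \ T).powersetCard 2).filter fun S =>
    (∀ x ∈ S, IsGammaPt T x) ∧ ∀ x ∈ S, ∀ y ∈ S, x ≠ y → ¬ SameRegion T x y).card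

open scoped Classical in
/-- Number of 2-element subsets `{x, y}` of `P \ T` such that `x` and `y` are both
β-points of `T` lying in the same region with respect to `T`. -/
noncomputable def betaSamePairs (P T : Finset (ℝ × ℝ)) : ℕ :=
  (((P \ T).powersetCard 2).filter fun S =>
    (∀ x ∈ S, IsBetaPt T x) ∧ ∀ x ∈ S, ∀ y ∈ S, x ≠ y → SameRegion T x y).card

open scoped Classical in
/-- Number of 2-element subsets `{x, y}` of `P \ T` such that `x` and `y` are both
β-points of `T` lying in distinct regions with respect to `T`. -/
noncomputable def betaDiffPairs (P T : Finset (ℝ × ℝ)) : ℕ :=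
  (((P \ T).powersetCard 2).filter fun S =>
    (∀ x ∈ S, IsBetaPt T x) ∧ ∀ x ∈ S, ∀ y ∈ S, x ≠ y → ¬ SameRegion T x y).card

/-! ### Orientation of triples -/

/-- Twice the signed area of the triangle with vertices `p`, `q`, `x`. -/
def orient (p q x : ℝ × ℝ) : ℝ :=
  (q.1 - p.1) * (x.2 - p.2) - (q.2 - p.2) * (x.1 - p.1)

lemma collinear_of_orient_eq_zero {p q x : ℝ × ℝ} (hpq : p ≠ q) (h : orient p q x = 0) :
    Collinear ℝ ({p, q, x} : Set (ℝ × ℝ)) := by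
  rw [collinear_iff_of_mem (p₀ := p) (by simp)]
  refine ⟨q - p, ?_⟩
  have hx : ∃ r : ℝ, x = r • (q - p) +ᵥ p := by
    unfold orient at h
    by_cases h1 : q.1 - p.1 = 0
    · have h2 : q.2 - p.2 ≠ 0 := fun h2 =>
        hpq (Prod.ext (by linarith) (by linarith))
      refine ⟨(x.2 - p.2) / (q.2 - p.2), Prod.ext ?_ ?_⟩
      · have : x.1 - p.1 = 0 := by
          rw [h1] at h
          have h3 : (q.2 - p.2) * (x.1 - p.1) = 0 := by linarith
          exact (mul_eq_zero.mp h3).resolve_left h2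
        simp [h1]
        linarith
      · simp
        field_simp
        ring
    · refine ⟨(x.1 - p.1) / (q.1 - p.1), Prod.ext ?_ ?_⟩
      · simp
        field_simp
        ring
      · simp
        field_simp
        linarith
  rintro z (rfl | rfl | rfl)
  · exact ⟨0, by simp⟩
  · exact ⟨1, by simp⟩
  · exact hx

lemma GenPos.orient_ne_zero {P : Finset (ℝ × ℝ)} (hP : GenPos P) {p q x : ℝ × ℝ}
    (hp : p ∈ P) (hq : q ∈ P) (hx : x ∈ P) (hpq : p ≠ q) (hpx : p ≠ x) (hqx : q ≠ x) :
    orient p q x ≠ 0 :=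
  fun h => hP p hp q hq x hx hpq hpx hqx (collinear_of_orient_eq_zero hpq h)

/-! ### Points inside triangles -/

/-- `z` lies in the relative interior of the triangle with vertices `u`, `v`, `w`. -/
def Inside (z u v w : ℝ × ℝ) : Prop :=
  ∃ α β γ : ℝ, 0 < α ∧ 0 < β ∧ 0 < γ ∧ α + β + γ = 1 ∧ z = α • u + β • v + γ • w

lemma Inside.rotate {z u v w : ℝ × ℝ} (h : Inside z u v w) : Inside z v w u := by
  obtain ⟨α, β, γ, hα, hβ, hγ, hs, rfl⟩ := h
  exact ⟨β, γ, α, hβ, hγ, hα, by linarith, by abel⟩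

lemma Inside.swap {z u v w : ℝ × ℝ} (h : Inside z u v w) : Inside z u w v := by
  obtain ⟨α, β, γ, hα, hβ, hγ, hs, rfl⟩ := h
  exact ⟨α, γ, β, hα, hγ, hβ, by linarith, by abel⟩

lemma orient_combination {α β γ : ℝ} (hs : α + β + γ = 1) (p q u v w : ℝ × ℝ) :
    orient p q (α • u + β • v + γ • w) =
      α * orient p q u + β * orient p q v + γ * orient p q w := by
  obtain rfl : α = 1 - β - γ := by linarith
  simp [orient]
  ring

lemma orient_left (p q : ℝ × ℝ) : orient p q p = 0 := by simp [orient]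

lemma orient_right (p q : ℝ × ℝ) : orient p q q = 0 := by simp [orient]; ring

lemma orient_swap (p q x : ℝ × ℝ) : orient q p x = -orient p q x := by simp [orient]; ring

lemma orient_rotate (p q x : ℝ × ℝ) : orient q x p = orient p q x := by simp [orient]; ring

lemma Inside.orient_mul_pos {z u v w : ℝ × ℝ} (h : Inside z u v w) (h0 : orient v w z ≠ 0) :
    0 < orient v w z * orient v w u := by
  obtain ⟨α, β, γ, hα, hβ, hγ, hs, rfl⟩ := h
  rw [orient_combination hs, orient_left, orient_right] at *
  have h1 : orient v w u ≠ 0 := fun h => h0 (by simp [h])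
  have := mul_pos hα (mul_self_pos.mpr h1)
  linarith

lemma Inside.orient_mul_neg {z u v w : ℝ × ℝ} (h : Inside z u v w) (h0 : orient z v w ≠ 0) :
    orient z v u * orient z v w < 0 := by
  obtain ⟨α, β, γ, hα, hβ, hγ, hs, hz⟩ := h
  have h1 := orient_combination hs z v u v w
  rw [← hz, orient_left, orient_right] at h1
  have h2 := mul_pos hγ (mul_self_pos.mpr h0)
  have h3 : α * (orient z v u * orient z v w) < 0 := by
    have : α * (orient z v u * orient z v w) = -(γ * (orient z v w * orient z v w)) := by
      linear_combination -orient z v w * h1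
    linarith
  exact (pos_iff_neg_of_mul_neg h3).mp hα

lemma mem_convexHull_pair {z u v : ℝ × ℝ} (h : z ∈ convexHull ℝ ({u, v} : Set (ℝ × ℝ))) :
    orient u v z = 0 := by
  rw [convexHull_pair] at h
  obtain ⟨a, b, -, -, hab, rfl⟩ := h
  have := orient_combination (α := a) (β := b) (γ := 0) (by linarith) u v u v u
  rw [orient_left, orient_right] at this
  simpa using this

lemma mem_convexHull_triple {z u v w : ℝ × ℝ} :
    z ∈ convexHull ℝ ({u, v, w} : Set (ℝ × ℝ)) ↔
      ∃ α β γ : ℝ, 0 ≤ α ∧ 0 ≤ β ∧ 0 ≤ γ ∧ α + β + γ = 1 ∧ z = α • u + β • v + γ • w := by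
  constructor
  · intro h
    rw [convexHull_insert (by simp), mem_convexJoin] at h
    obtain ⟨_, rfl, b, hb, α, δ, hα, hδ, hs, rfl⟩ := h
    rw [convexHull_pair] at hb
    obtain ⟨β, γ, hβ, hγ, hs', rfl⟩ := hb
    refine ⟨α, δ * β, δ * γ, hα, by positivity, by positivity, ?_, ?_⟩
    · rw [add_assoc, ← mul_add, hs', mul_one, hs]
    · rw [smul_add, smul_smul, smul_smul, add_assoc]
  · rintro ⟨α, β, γ, hα, hβ, hγ, hs, rfl⟩
    have hc := convex_convexHull ℝ ({u, v, w} : Set (ℝ × ℝ))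
    have hsub := subset_convexHull ℝ ({u, v, w} : Set (ℝ × ℝ))
    have := hc.sum_mem (t := Finset.univ) (w := ![α, β, γ]) (z := ![u, v, w])
      (by intro i _; fin_cases i <;> simpa) (by simpa [Fin.sum_univ_three] using hs)
      (by intro i _; apply hsub; fin_cases i <;> simp)
    simpa [Fin.sum_univ_three] using this

lemma Inside.mem_convexHull {z u v w : ℝ × ℝ} (h : Inside z u v w) :
    z ∈ convexHull ℝ ({u, v, w} : Set (ℝ × ℝ)) := by
  obtain ⟨α, β, γ, hα, hβ, hγ, h⟩ := h
  exact mem_convexHull_triple.mpr ⟨α, β, γ, hα.le, hβ.le, hγ.le, h⟩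

lemma inside_of_mem_convexHull {z u v w : ℝ × ℝ}
    (h : z ∈ convexHull ℝ ({u, v, w} : Set (ℝ × ℝ))) (hu : orient v w z ≠ 0)
    (hv : orient u w z ≠ 0) (hw : orient u v z ≠ 0) : Inside z u v w := by
  obtain ⟨α, β, γ, hα, hβ, hγ, hs, rfl⟩ := mem_convexHull_triple.mp h
  rw [orient_combination hs, orient_left, orient_right] at hu hv hw
  refine ⟨α, β, γ, hα.lt_of_ne ?_, hβ.lt_of_ne ?_, hγ.lt_of_ne ?_, hs, rfl⟩ <;>
  · rintro rfl
    simp_all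

lemma GenPos.inside_of_mem_convexHull {P : Finset (ℝ × ℝ)} (hP : GenPos P) {z u v w : ℝ × ℝ}
    (hz : z ∈ P) (hu : u ∈ P) (hv : v ∈ P) (hw : w ∈ P) (huv : u ≠ v) (huw : u ≠ w)
    (hvw : v ≠ w) (hzu : u ≠ z) (hzv : v ≠ z) (hzw : w ≠ z)
    (h : z ∈ convexHull ℝ ({u, v, w} : Set (ℝ × ℝ))) : Inside z u v w :=
  _root_.inside_of_mem_convexHull h (hP.orient_ne_zero hv hw hz hvw hzv hzw)
    (hP.orient_ne_zero hu hw hz huw hzu hzw) (hP.orient_ne_zero hu hv hz huv hzu hzv)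

/-! ### Extreme points of the hull of a finite set -/

lemma convexHull_extremePoints_of_finite {S : Set (ℝ × ℝ)} (hS : S.Finite) :
    convexHull ℝ (Set.extremePoints ℝ (convexHull ℝ S)) = convexHull ℝ S := by
  have h := closure_convexHull_extremePoints (hS.isCompact_convexHull ℝ) (convex_convexHull ℝ S)
  rwa [((hS.subset extremePoints_convexHull_subset).isClosed_convexHull ℝ).closure_eq] at h

lemma mem_extremePoints_convexHull_iff {S : Set (ℝ × ℝ)} (hS : S.Finite) {z : ℝ × ℝ}
    (hz : z ∈ S) :
    z ∈ Set.extremePoints ℝ (convexHull ℝ S) ↔ z ∉ convexHull ℝ (S \ {z}) := by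
  constructor
  · intro h h'
    rw [(convex_convexHull ℝ S).mem_extremePoints_iff_mem_sdiff_convexHull_sdiff] at h
    exact h.2 (convexHull_mono (Set.sdiff_subset_sdiff_left (subset_convexHull ℝ S)) h')
  · contrapose!
    intro h
    have h1 : z ∈ convexHull ℝ (Set.extremePoints ℝ (convexHull ℝ S)) := by
      rw [convexHull_extremePoints_of_finite hS]
      exact subset_convexHull ℝ S hz
    have h2 : Set.extremePoints ℝ (convexHull ℝ S) ⊆ S \ {z} := by
      refine fun y hy => ⟨extremePoints_convexHull_subset hy, ?_⟩
      rintro rfl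
      exact h hy
    exact convexHull_mono h2 h1

lemma extremePoints_convexHull_triple {x y c : ℝ × ℝ} (h : orient x y c ≠ 0) :
    Set.extremePoints ℝ (convexHull ℝ ({x, y, c} : Set (ℝ × ℝ))) = {x, y, c} := by
  refine extremePoints_convexHull_subset.antisymm fun z hz => ?_
  rw [mem_extremePoints_convexHull_iff (by simp) hz]
  intro h'
  apply h
  rcases hz with rfl | rfl | rfl
  · rw [← orient_rotate]
    exact mem_convexHull_pair (convexHull_mono (by rintro _ ⟨rfl | rfl | rfl, h⟩ <;> simp_all) h')
  · rw [← orient_rotate, ← orient_rotate]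
    exact mem_convexHull_pair (convexHull_mono (by rintro _ ⟨rfl | rfl | rfl, h⟩ <;> simp_all) h')
  · exact mem_convexHull_pair (convexHull_mono (by rintro _ ⟨rfl | rfl | rfl, h⟩ <;> simp_all) h')

/-! ### β-points and regions -/

lemma IsBetaPt.inside {P : Finset (ℝ × ℝ)} (hP : GenPos P) {a b c x : ℝ × ℝ}
    (ha : a ∈ P) (hb : b ∈ P) (hc : c ∈ P) (hx : x ∈ P) (hab : a ≠ b) (hac : a ≠ c)
    (hbc : b ≠ c) (hax : a ≠ x) (hbx : b ≠ x) (hcx : c ≠ x)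
    (h : IsBetaPt {a, b, c} x) :
    Inside a x b c ∨ Inside b x a c ∨ Inside c x a b := by
  obtain ⟨h1, h2⟩ := h
  unfold ConvexPos at h1
  push Not at h1
  obtain ⟨z, hz, h1⟩ := h1
  rw [mem_extremePoints_convexHull_iff (Finset.finite_toSet _) hz, not_not] at h1
  simp only [Finset.mem_insert, Finset.mem_singleton] at hz
  have key : ∀ {z u v w : ℝ × ℝ}, ((insert x {a, b, c} : Finset (ℝ × ℝ)) : Set (ℝ × ℝ)) \ {z} ⊆
      {u, v, w} → z ∈ convexHull ℝ (((insert x {a, b, c} : Finset (ℝ × ℝ)) : Set (ℝ × ℝ)) \ {z}) →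
      z ∈ convexHull ℝ ({u, v, w} : Set (ℝ × ℝ)) := fun hs hz => convexHull_mono hs hz
  rcases hz with rfl | rfl | rfl | rfl
  · refine absurd (key (u := a) (v := b) (w := c) ?_ h1) (by simpa using h2)
    intro y; simp; tauto
  · left
    refine hP.inside_of_mem_convexHull ha hx hb hc hbx.symm hcx.symm hbc hax.symm hab.symm hac.symm
      (key ?_ h1)
    intro y; simp; tauto
  · right; left
    refine hP.inside_of_mem_convexHull hb hx ha hc hax.symm hcx.symm hac hbx.symm hab hbc.symm
      (key ?_ h1)
    intro y; simp; tauto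
  · right; right
    refine hP.inside_of_mem_convexHull hc hx ha hb hax.symm hbx.symm hab hcx.symm hac hbc
      (key ?_ h1)
    intro y; simp; tauto

lemma Inside.isBetaPt {a b c x : ℝ × ℝ} (h : Inside a x b c) (h0 : orient a b c ≠ 0)
    (hax : a ≠ x) {T : Finset (ℝ × ℝ)} (hT : T = {a, b, c}) : IsBetaPt T x := by
  have hab : a ≠ b := by rintro rfl; simp [orient] at h0
  have hac : a ≠ c := by rintro rfl; simp [orient_left] at h0
  subst hT
  refine ⟨fun hc => ?_, fun hx => ?_⟩
  · have := hc a (by simp)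
    rw [mem_extremePoints_convexHull_iff (Finset.finite_toSet _) (by simp)] at this
    refine this (convexHull_mono ?_ h.mem_convexHull)
    rintro _ (rfl | rfl | rfl)
    · simpa using hax.symm
    · simpa using hab.symm
    · simpa using hac.symm
  · have hx' : x ∈ convexHull ℝ ({a, b, c} : Set (ℝ × ℝ)) := by simpa using hx
    obtain ⟨α', β', γ', hα', hβ', hγ', hs', hx'⟩ := mem_convexHull_triple.mp hx'
    have h1 := orient_combination hs' b c a b c
    rw [← hx', orient_left, orient_right] at h1
    obtain ⟨α, β, γ, hα, hβ, hγ, hs, ha⟩ := h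
    have h2 := orient_combination hs b c x b c
    rw [← ha, orient_left, orient_right, h1] at h2
    have h3 : orient b c a ≠ 0 := by rwa [orient_rotate]
    have h4 : α * α' = 1 := mul_right_cancel₀ h3 (by linarith)
    nlinarith

lemma mul_pos_of_mul_pos {r s t : ℝ} (h1 : 0 < s * r) (h2 : 0 < t * r) : 0 < s * t := by
  have h3 : 0 < r * r * (s * t) := by nlinarith [mul_pos h1 h2]
  exact pos_of_mul_pos_right h3 (mul_self_nonneg r)

lemma mul_pos_of_mul_neg {r s t : ℝ} (h1 : s * r < 0) (h2 : t * r < 0) : 0 < s * t :=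
  mul_pos_of_mul_pos (r := -r) (by linarith) (by linarith)

lemma mul_neg_of_mul_pos_of_mul_neg {r s t : ℝ} (h1 : 0 < s * r) (h2 : t * r < 0) : s * t < 0 := by
  have := mul_pos_of_mul_pos (s := s) (t := -t) (r := r) h1 (by linarith)
  linarith

lemma SameSide.swap {p q x y : ℝ × ℝ} (h : SameSide p q x y) : SameSide q p x y := by
  change 0 < orient q p x * orient q p y
  rwa [orient_swap p q x, orient_swap p q y, neg_mul_neg]

lemma orient_ne_zero_swap {a b c : ℝ × ℝ} (h : orient a b c ≠ 0) : orient a c b ≠ 0 := by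
  have h1 : orient a c b = -orient a b c := by
    simp [orient]
    ring
  rw [h1]
  exact neg_ne_zero.mpr h

lemma Inside.sameRegion {a b c x y : ℝ × ℝ} (hx : Inside a x b c) (hy : Inside a y b c)
    (h0 : orient a b c ≠ 0) {T : Finset (ℝ × ℝ)} (hT : T = {a, b, c}) : SameRegion T x y := by
  have ha : orient b c a ≠ 0 := by rwa [orient_rotate]
  have h0' := orient_ne_zero_swap h0
  have hbc : SameSide b c x y :=
    mul_pos_of_mul_pos (s := orient b c x) (t := orient b c y) (r := orient b c a)
      (by linarith [hx.orient_mul_pos ha]) (by linarith [hy.orient_mul_pos ha])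
  have hab : SameSide a b x y :=
    mul_pos_of_mul_neg (hx.orient_mul_neg h0) (hy.orient_mul_neg h0)
  have hac : SameSide a c x y :=
    mul_pos_of_mul_neg (hx.swap.orient_mul_neg h0') (hy.swap.orient_mul_neg h0')
  subst hT
  intro p hp q hq hpq
  simp only [Finset.mem_insert, Finset.mem_singleton] at hp hq
  rcases hp with rfl | rfl | rfl <;> rcases hq with rfl | rfl | rfl <;>
    first
    | exact absurd rfl hpq
    | assumption
    | (apply SameSide.swap; assumption)

lemma Inside.not_sameRegion {a b c x y : ℝ × ℝ} (hx : Inside a x b c) (hy : Inside b y a c)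
    (h0 : orient a b c ≠ 0) {T : Finset (ℝ × ℝ)} (hT : T = {a, b, c}) :
    ¬ SameRegion T x y := by
  have h0' := orient_ne_zero_swap h0
  have hac : a ≠ c := by rintro rfl; simp [orient_left] at h0
  intro h
  have h1 : 0 < orient a c x * orient a c y := h a (by simp [hT]) c (by simp [hT]) hac
  have h2 := hx.swap.orient_mul_neg h0'
  have h3 := hy.orient_mul_pos h0'
  have h4 := mul_neg_of_mul_pos_of_mul_neg (r := orient a c b) (s := orient a c y)
    (t := orient a c x) (by linarith) h2
  linarith

/-! ### Configurations of β-points in distinct regions -/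

/-- Five points of `P`, where `x` and `y` are β-points of `{a, b, c}` in the regions at `a` and
at `b` respectively. -/
structure BetaConfig (P : Finset (ℝ × ℝ)) (a b c x y : ℝ × ℝ) : Prop where
  nodup : [a, b, c, x, y].Nodup
  mem : ∀ z ∈ [a, b, c, x, y], z ∈ P
  inside_left : Inside a x b c
  inside_right : Inside b y a c

lemma BetaConfig.of_disjoint {P T U : Finset (ℝ × ℝ)} {a b c x y : ℝ × ℝ}
    (hT : T ∈ P.powersetCard 3) (hU : U ∈ (P \ T).powersetCard 2)
    (hTe : T = {a, b, c}) (hUe : U = {x, y}) (h1 : Inside a x b c) (h2 : Inside b y a c) :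
    BetaConfig P a b c x y := by
  rw [Finset.mem_powersetCard] at hT hU
  obtain ⟨hTP, hT3⟩ := hT
  obtain ⟨hUP, hU2⟩ := hU
  have hTm : ∀ z ∈ T, z ∈ P := fun z hz => hTP hz
  have hUm : ∀ z ∈ U, z ∈ P ∧ z ∉ T := fun z hz => Finset.mem_sdiff.mp (hUP hz)
  subst hTe hUe
  refine ⟨?_, ?_, h1, h2⟩
  · have hc : (insert x (insert y {a, b, c}) : Finset (ℝ × ℝ)).card = 5 := by
      have hxy : x ≠ y := by rintro rfl; simp at hU2
      rw [Finset.card_insert_of_notMem, Finset.card_insert_of_notMem, hT3]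
      · exact (hUm y (by simp)).2
      · rw [Finset.mem_insert, not_or]
        exact ⟨hxy, (hUm x (by simp)).2⟩
    rw [← Multiset.coe_nodup, ← Multiset.toFinset_card_eq_card_iff_nodup]
    simp only [Multiset.coe_card, List.length_cons, List.length_nil]
    refine Eq.trans (congrArg _ ?_) hc
    ext z
    simp
    tauto
  · simp only [Finset.mem_insert, Finset.mem_singleton] at hTm hUm
    simp only [List.mem_cons, List.not_mem_nil, or_false]
    rintro z (rfl | rfl | rfl | rfl | rfl)
    · exact hTm _ (by simp)
    · exact hTm _ (by simp)
    · exact hTm _ (by simp)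
    · exact (hUm _ (by simp)).1
    · exact (hUm _ (by simp)).1

lemma BetaConfig.orient_left_neg {P : Finset (ℝ × ℝ)} (hP : GenPos P) {a b c x y : ℝ × ℝ}
    (h : BetaConfig P a b c x y) : orient a b x * orient a b c < 0 := by
  obtain ⟨hn, hm, h1, h2⟩ := h
  simp only [List.nodup_cons, List.mem_cons, List.not_mem_nil, or_false, not_or] at hn hm
  exact h1.orient_mul_neg (hP.orient_ne_zero (hm _ (by simp)) (hm _ (by simp)) (hm _ (by simp))
    (by tauto) (by tauto) (by tauto))

lemma BetaConfig.symm {P : Finset (ℝ × ℝ)} {a b c x y : ℝ × ℝ}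
    (h : BetaConfig P a b c x y) : BetaConfig P b a c y x := by
  obtain ⟨hn, hm, h1, h2⟩ := h
  refine ⟨?_, fun z hz => hm z ?_, h2, h1⟩
  · simp at hn ⊢
    grind
  · simp at hz ⊢
    tauto

lemma BetaConfig.orient_right_neg {P : Finset (ℝ × ℝ)} (hP : GenPos P) {a b c x y : ℝ × ℝ}
    (h : BetaConfig P a b c x y) : orient a b y * orient a b c < 0 := by
  have := h.symm.orient_left_neg hP
  rwa [orient_swap a b y, orient_swap a b c, neg_mul_neg] at this

lemma BetaConfig.extremePoints {P : Finset (ℝ × ℝ)} (hP : GenPos P) {a b c x y : ℝ × ℝ}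
    (h : BetaConfig P a b c x y) {S : Finset (ℝ × ℝ)} (hS : S = {a, b, c, x, y}) :
    Set.extremePoints ℝ (convexHull ℝ (S : Set (ℝ × ℝ))) = {x, y, c} := by
  have key : ∀ {a b c x y : ℝ × ℝ}, Inside a x b c → Inside b y a c →
      a ∈ convexHull ℝ ({x, y, c} : Set (ℝ × ℝ)) := by
    rintro a b c x y ⟨α, β, γ, hα, hβ, hγ, hs, h⟩ ⟨α', β', γ', hα', hβ', hγ', hs', h'⟩
    rw [mem_convexHull_triple]
    have hd : 0 < 1 - β * β' := by nlinarith
    have e1 := congrArg Prod.fst h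
    have e2 := congrArg Prod.snd h
    have e3 := congrArg Prod.fst h'
    have e4 := congrArg Prod.snd h'
    simp at e1 e2 e3 e4
    refine ⟨α / (1 - β * β'), β * α' / (1 - β * β'), (γ + β * γ') / (1 - β * β'), by positivity,
      by positivity, by positivity, ?_, ?_⟩
    · field_simp
      linear_combination hs + β * hs'
    · ext
      · simp
        field_simp
        linear_combination e1 + β * e3
      · simp
        field_simp
        linear_combination e2 + β * e4
  obtain ⟨hn, hm, h1, h2⟩ := h
  simp only [List.nodup_cons, List.mem_cons, List.not_mem_nil, or_false, not_or] at hn hm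
  rw [← extremePoints_convexHull_triple (hP.orient_ne_zero (hm x (by simp)) (hm y (by simp))
    (hm c (by simp)) (by tauto) (by tauto) (by tauto))]
  congr 1
  have hsub := subset_convexHull ℝ ({x, y, c} : Set (ℝ × ℝ))
  refine (convexHull_min ?_ (convex_convexHull ℝ _)).antisymm (convexHull_mono ?_)
  · intro z hz
    simp [hS] at hz
    rcases hz with rfl | rfl | rfl | rfl | rfl
    · exact key h1 h2
    · rw [Set.insert_comm]
      exact key h2 h1
    all_goals exact hsub (by simp)
  · rintro z (rfl | rfl | rfl) <;> simp [hS]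

lemma betaDiff_iff {P T U : Finset (ℝ × ℝ)} (hP : GenPos P) (hT : T ∈ P.powersetCard 3)
    (hU : U ∈ (P \ T).powersetCard 2) :
    ((∀ x ∈ U, IsBetaPt T x) ∧ ∀ x ∈ U, ∀ y ∈ U, x ≠ y → ¬ SameRegion T x y) ↔
      ∃ a b c x y, T = {a, b, c} ∧ U = {x, y} ∧ BetaConfig P a b c x y := by
  constructor
  · rintro ⟨h1, h2⟩
    have hT' := Finset.mem_powersetCard.mp hT
    have hU' := Finset.mem_powersetCard.mp hU
    obtain ⟨a, b, c, hab, hac, hbc, hTe⟩ := Finset.card_eq_three.mp hT'.2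
    obtain ⟨x, y, hxy, hUe⟩ := Finset.card_eq_two.mp hU'.2
    have ha : a ∈ P := hT'.1 (by simp [hTe])
    have hb : b ∈ P := hT'.1 (by simp [hTe])
    have hc : c ∈ P := hT'.1 (by simp [hTe])
    have key : ∀ z ∈ U, Inside a z b c ∨ Inside b z a c ∨ Inside c z a b := by
      intro z hz
      have hzP := Finset.mem_sdiff.mp (hU'.1 hz)
      simp only [hTe, Finset.mem_insert, Finset.mem_singleton, not_or] at hzP
      exact (hTe ▸ h1 z hz).inside hP ha hb hc hzP.1 hab hac hbc (Ne.symm hzP.2.1)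
        (Ne.symm hzP.2.2.1) (Ne.symm hzP.2.2.2)
    have h3 := h2 x (by simp [hUe]) y (by simp [hUe]) hxy
    have make : ∀ {a b c : ℝ × ℝ}, T = {a, b, c} → Inside a x b c → Inside b y a c →
        ∃ a b c x y, T = {a, b, c} ∧ U = {x, y} ∧ BetaConfig P a b c x y :=
      fun hTe h1 h2 => ⟨_, _, _, x, y, hTe, hUe, .of_disjoint hT hU hTe hUe h1 h2⟩
    have e1 : T = {a, c, b} := by rw [hTe]; ext; simp; tauto
    have e2 : T = {b, a, c} := by rw [hTe]; ext; simp; tauto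
    have e3 : T = {b, c, a} := by rw [hTe]; ext; simp; tauto
    have e4 : T = {c, a, b} := by rw [hTe]; ext; simp; tauto
    have e5 : T = {c, b, a} := by rw [hTe]; ext; simp; tauto
    rcases key x (by simp [hUe]) with hx | hx | hx <;>
      rcases key y (by simp [hUe]) with hy | hy | hy
    · exact absurd (hx.sameRegion hy (hP.orient_ne_zero ha hb hc hab hac hbc) hTe) h3
    · exact make hTe hx hy
    · exact make e1 hx.swap hy
    · exact make e2 hx hy
    · exact absurd (hx.sameRegion hy (hP.orient_ne_zero hb ha hc hab.symm hbc hac) e2) h3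
    · exact make e3 hx.swap hy.swap
    · exact make e4 hx hy.swap
    · exact make e5 hx.swap hy.swap
    · exact absurd (hx.sameRegion hy (hP.orient_ne_zero hc ha hb hac.symm hbc.symm hab) e4) h3
  · rintro ⟨a, b, c, x, y, hTe, hUe, hn, hm, h1, h2⟩
    simp only [List.nodup_cons, List.mem_cons, List.not_mem_nil, or_false, not_or] at hn hm
    have h0 : orient a b c ≠ 0 := hP.orient_ne_zero (hm _ (by simp)) (hm _ (by simp))
      (hm _ (by simp)) (by tauto) (by tauto) (by tauto)
    have h0' : orient b a c ≠ 0 := by rwa [orient_swap, neg_ne_zero]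
    have e2 : T = {b, a, c} := by rw [hTe]; ext; simp; tauto
    constructor
    · intro z hz
      simp only [hUe, Finset.mem_insert, Finset.mem_singleton] at hz
      rcases hz with rfl | rfl
      · exact h1.isBetaPt h0 (by tauto) hTe
      · exact h2.isBetaPt h0' (by tauto) e2
    · intro z hz w hw hzw
      simp only [hUe, Finset.mem_insert, Finset.mem_singleton] at hz hw
      rcases hz with rfl | rfl <;> rcases hw with rfl | rfl
      · exact absurd rfl hzw
      · exact h1.not_sameRegion h2 h0 hTe
      · exact h2.not_sameRegion h1 h0' e2
      · exact absurd rfl hzw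

lemma BetaConfig.eq_of_extremePoints_eq {P : Finset (ℝ × ℝ)} (hP : GenPos P)
    {a b c x y c' x' y' : ℝ × ℝ} (h : BetaConfig P a b c x y) (h' : BetaConfig P a b c' x' y')
    (he : ({x, y, c} : Set (ℝ × ℝ)) = {x', y', c'}) :
    c = c' ∧ ({x, y} : Finset (ℝ × ℝ)) = {x', y'} := by
  have hx := h.orient_left_neg hP
  have hy := h.orient_right_neg hP
  have hx' := h'.orient_left_neg hP
  have hy' := h'.orient_right_neg hP
  have hxy := mul_pos_of_mul_neg hx hy
  have hn := h.nodup
  have hn' := h'.nodup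
  simp only [List.nodup_cons, List.mem_cons, List.not_mem_nil, or_false, not_or] at hn hn'
  simp only [Set.ext_iff, Set.mem_insert_iff, Set.mem_singleton_iff] at he
  have hother : ∀ z, z = x ∨ z = y → z ≠ c' → orient a b z * orient a b c' < 0 := by
    intro z hz hzc
    rcases (he z).mp (by tauto) with rfl | rfl | rfl
    · exact hx'
    · exact hy'
    · exact absurd rfl hzc
  have hc : c = c' := by
    rcases (he c').mpr (by tauto) with rfl | rfl | rfl
    · have := hother y (by tauto) (by tauto)
      linarith
    · have := hother x (by tauto) (by tauto)
      linarith
    · rfl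
  refine ⟨hc, ?_⟩
  ext z
  have := he z
  simp only [Finset.mem_insert, Finset.mem_singleton]
  grind

lemma BetaConfig.unique {P : Finset (ℝ × ℝ)} (hP : GenPos P) {a b c x y a' b' c' x' y' : ℝ × ℝ}
    (h : BetaConfig P a b c x y) (h' : BetaConfig P a' b' c' x' y')
    (hS : ({a, b, c, x, y} : Finset (ℝ × ℝ)) = {a', b', c', x', y'}) :
    ({a, b, c} : Finset (ℝ × ℝ)) = {a', b', c'} ∧ ({x, y} : Finset (ℝ × ℝ)) = {x', y'} := by
  have he : ({x, y, c} : Set (ℝ × ℝ)) = {x', y', c'} := by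
    rw [← h.extremePoints hP hS.symm, ← h'.extremePoints hP rfl]
  have hab : (a' = a ∧ b' = b) ∨ (a' = b ∧ b' = a) := by
    have hn := h.nodup
    have hn' := h'.nodup
    simp only [List.nodup_cons, List.mem_cons, List.not_mem_nil, or_false, not_or] at hn hn'
    simp only [Set.ext_iff, Set.mem_insert_iff, Set.mem_singleton_iff] at he
    simp only [Finset.ext_iff, Finset.mem_insert, Finset.mem_singleton] at hS
    have s1 := (hS a').mpr (by tauto)
    have s2 := (hS b').mpr (by tauto)
    have e1 := he a'
    have e2 := he b'
    grind
  rcases hab with ⟨rfl, rfl⟩ | ⟨rfl, rfl⟩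
  · obtain ⟨rfl, hU⟩ := h.eq_of_extremePoints_eq hP h' he
    exact ⟨rfl, hU⟩
  · obtain ⟨rfl, hU⟩ := h.eq_of_extremePoints_eq hP h'.symm (he.trans (Set.insert_comm _ _ _))
    exact ⟨Finset.insert_comm _ _ _, hU.trans (Finset.pair_comm _ _)⟩

lemma Inside.exchange {p q u v w : ℝ × ℝ} (hp : Inside p u v w) (hq : Inside q u v w)
    (hu : orient p q u * orient p q w < 0) (hv : orient p q v * orient p q w < 0) :
    (Inside p u q w ∧ Inside q v p w) ∨ (Inside p v q w ∧ Inside q u p w) := by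
  have key : ∀ {p q u v w : ℝ × ℝ} {α β γ α' β' γ' : ℝ}, 0 < α → 0 < β → 0 < α' → 0 < β' →
      α + β + γ = 1 → α' + β' + γ' = 1 → p = α • u + β • v + γ • w →
      q = α' • u + β' • v + γ' • w → 0 < α * β' - β * α' → 0 < γ * β' - β * γ' →
      0 < γ' * α - γ * α' → Inside p u q w ∧ Inside q v p w := by
    intro p q u v w α β γ α' β' γ' hα hβ hα' hβ' hs hs' hp hq h1 h2 h3
    refine ⟨⟨(α * β' - β * α') / β', β / β', (γ * β' - β * γ') / β', by positivity, by positivity,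
      by positivity, ?_, ?_⟩, ⟨(α * β' - β * α') / α, α' / α, (γ' * α - γ * α') / α, by positivity,
      by positivity, by positivity, ?_, ?_⟩⟩
    · field_simp
      linear_combination β' * hs - β * hs'
    · rw [hq, hp]
      ext <;> simp <;> field_simp <;> ring
    · field_simp
      linear_combination α * hs' - α' * hs
    · rw [hq, hp]
      ext <;> simp <;> field_simp <;> ring
  obtain ⟨α, β, γ, hα, hβ, hγ, hs, hp⟩ := hp
  obtain ⟨α', β', γ', hα', hβ', hγ', hs', hq⟩ := hq
  have ow : orient p q w = (α * β' - β * α') * orient u v w := by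
    obtain rfl : γ = 1 - α - β := by linarith
    obtain rfl : γ' = 1 - α' - β' := by linarith
    rw [hp, hq]; simp [orient]; ring
  have ou : orient p q u = (β * γ' - γ * β') * orient u v w := by
    obtain rfl : α = 1 - γ - β := by linarith
    obtain rfl : α' = 1 - γ' - β' := by linarith
    rw [hp, hq]; simp [orient]; ring
  have ov : orient p q v = (γ * α' - α * γ') * orient u v w := by
    obtain rfl : β = 1 - γ - α := by linarith
    obtain rfl : β' = 1 - γ' - α' := by linarith
    rw [hp, hq]; simp [orient]; ring
  have cancel : ∀ {s t : ℝ}, (s * orient u v w) * (t * orient u v w) < 0 → s * t < 0 := by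
    intro s t h
    by_contra! h'
    have := mul_nonneg h' (mul_self_nonneg (orient u v w))
    linarith
  rw [ou, ow] at hu
  rw [ov, ow] at hv
  have hu := cancel hu
  have hv := cancel hv
  rcases lt_trichotomy 0 (α * β' - β * α') with h | h | h
  · left
    exact key hα hβ hα' hβ' hs hs' hp hq h
      (by linarith [neg_of_mul_neg_left hu h.le]) (by linarith [neg_of_mul_neg_left hv h.le])
  · rw [← h] at hu
    simp at hu
  · right
    have h1 := pos_of_mul_neg_left hu h.le
    have h2 := pos_of_mul_neg_left hv h.le
    exact key (γ := γ) (γ' := γ') hβ hα hβ' hα' (by linarith) (by linarith)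
      (hp.trans (by abel)) (hq.trans (by abel))
      (by linarith) (by linarith) (by linarith)

lemma exists_betaConfig {P : Finset (ℝ × ℝ)} (hP : GenPos P) {p q u v w : ℝ × ℝ}
    (hn : [p, q, u, v, w].Nodup) (hm : ∀ z ∈ [p, q, u, v, w], z ∈ P) (hp : Inside p u v w)
    (hq : Inside q u v w) :
    ∃ a b c x y, BetaConfig P a b c x y ∧
      ∀ z, z ∈ [a, b, c, x, y] ↔ z ∈ [p, q, u, v, w] := by
  have key : ∀ {u v w : ℝ × ℝ}, [p, q, u, v, w].Nodup → (∀ z ∈ [p, q, u, v, w], z ∈ P) →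
      Inside p u v w → Inside q u v w → orient p q u * orient p q w < 0 →
      orient p q v * orient p q w < 0 →
      ∃ a b c x y, BetaConfig P a b c x y ∧
        ∀ z, z ∈ [a, b, c, x, y] ↔ z ∈ [p, q, u, v, w] := by
    intro u v w hn hm hp hq hu hv
    rcases hp.exchange hq hu hv with ⟨h1, h2⟩ | ⟨h1, h2⟩
    · have hz : ∀ z, z ∈ [p, q, w, u, v] ↔ z ∈ [p, q, u, v, w] := by
        intro z; simp; tauto
      refine ⟨p, q, w, u, v, ⟨?_, fun z h => hm z ((hz z).mp h), h1, h2⟩, hz⟩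
      simp at hn ⊢
      grind
    · have hz : ∀ z, z ∈ [p, q, w, v, u] ↔ z ∈ [p, q, u, v, w] := by
        intro z; simp; tauto
      refine ⟨p, q, w, v, u, ⟨?_, fun z h => hm z ((hz z).mp h), h1, h2⟩, hz⟩
      simp at hn ⊢
      grind
  have hn1 : [p, q, v, w, u].Nodup := by simp at hn ⊢; grind
  have hn2 : [p, q, w, u, v].Nodup := by simp at hn ⊢; grind
  have hz1 : ∀ z, z ∈ [p, q, v, w, u] ↔ z ∈ [p, q, u, v, w] := by intro z; simp; tauto
  have hz2 : ∀ z, z ∈ [p, q, w, u, v] ↔ z ∈ [p, q, u, v, w] := by intro z; simp; tauto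
  have hne : ∀ z, z ∈ [u, v, w] → orient p q z ≠ 0 := by
    intro z hz
    simp at hn hz
    refine hP.orient_ne_zero (hm _ (by simp)) (hm _ (by simp)) (hm _ ?_) (by tauto) ?_ ?_
    · simp; tauto
    · rintro rfl; tauto
    · rintro rfl; tauto
  have hu := hne u (by simp)
  have hv := hne v (by simp)
  have hw := hne w (by simp)
  obtain ⟨α, β, γ, hα, hβ, hγ, hs, hpe⟩ := id hp
  have hsum := orient_combination hs p q u v w
  rw [← hpe, orient_left] at hsum
  have transfer : ∀ {u' v' w' : ℝ × ℝ}, (∀ z, z ∈ [p, q, u', v', w'] ↔ z ∈ [p, q, u, v, w]) →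
      (∃ a b c x y, BetaConfig P a b c x y ∧
        ∀ z, z ∈ [a, b, c, x, y] ↔ z ∈ [p, q, u', v', w']) →
      ∃ a b c x y, BetaConfig P a b c x y ∧
        ∀ z, z ∈ [a, b, c, x, y] ↔ z ∈ [p, q, u, v, w] := by
    rintro u' v' w' hz ⟨a, b, c, x, y, h, h'⟩
    exact ⟨a, b, c, x, y, h, fun z => (h' z).trans (hz z)⟩
  have onU := fun h1 h2 => transfer hz1
    (key hn1 (fun z h => hm z ((hz1 z).mp h)) hp.rotate hq.rotate h1 h2)
  have onV := fun h1 h2 => transfer hz2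
    (key hn2 (fun z h => hm z ((hz2 z).mp h)) hp.rotate.rotate hq.rotate.rotate h1 h2)
  have onW := key hn hm hp hq
  rcases hu.lt_or_gt with h1 | h1 <;> rcases hv.lt_or_gt with h2 | h2 <;>
    rcases hw.lt_or_gt with h3 | h3
  · nlinarith [mul_pos_of_neg_of_neg (neg_neg_of_pos hα) h1,
      mul_pos_of_neg_of_neg (neg_neg_of_pos hβ) h2, mul_pos_of_neg_of_neg (neg_neg_of_pos hγ) h3]
  · exact onW (mul_neg_of_neg_of_pos h1 h3) (mul_neg_of_neg_of_pos h2 h3)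
  · exact onV (mul_neg_of_neg_of_pos h3 h2) (mul_neg_of_neg_of_pos h1 h2)
  · exact onU (mul_neg_of_pos_of_neg h2 h1) (mul_neg_of_pos_of_neg h3 h1)
  · exact onU (mul_neg_of_neg_of_pos h2 h1) (mul_neg_of_neg_of_pos h3 h1)
  · exact onV (mul_neg_of_pos_of_neg h3 h2) (mul_neg_of_pos_of_neg h1 h2)
  · exact onW (mul_neg_of_pos_of_neg h1 h3) (mul_neg_of_pos_of_neg h2 h3)
  · nlinarith [mul_pos hα h1, mul_pos hβ h2, mul_pos hγ h3]

lemma exists_betaConfig_of_ncard_extremePoints {P S : Finset (ℝ × ℝ)} (hP : GenPos P)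
    (hS : S ∈ P.powersetCard 5)
    (h : (Set.extremePoints ℝ (convexHull ℝ (S : Set (ℝ × ℝ)))).ncard = 3) :
    ∃ a b c x y, BetaConfig P a b c x y ∧ S = {a, b, c, x, y} := by
  classical
  obtain ⟨hSP, hS5⟩ := Finset.mem_powersetCard.mp hS
  have hsub : Set.extremePoints ℝ (convexHull ℝ (S : Set (ℝ × ℝ))) ⊆ S :=
    extremePoints_convexHull_subset
  obtain ⟨E, hE⟩ := (S.finite_toSet.subset hsub).exists_finset_coe
  have hull : convexHull ℝ (E : Set (ℝ × ℝ)) = convexHull ℝ (S : Set (ℝ × ℝ)) := by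
    rw [hE, convexHull_extremePoints_of_finite S.finite_toSet]
  rw [← hE, Set.ncard_coe_finset] at h
  have hES : E ⊆ S := by rw [← hE] at hsub; exact_mod_cast hsub
  have hd : (S \ E).card = 2 := by rw [Finset.card_sdiff_of_subset hES, hS5, h]
  obtain ⟨u, v, w, huv, huw, hvw, hEe⟩ := Finset.card_eq_three.mp h
  obtain ⟨p, q, hpq, hDe⟩ := Finset.card_eq_two.mp hd
  have hD : ∀ z, z = p ∨ z = q → z ∈ S ∧ z ≠ u ∧ z ≠ v ∧ z ≠ w := by
    intro z hz
    have : z ∈ S \ E := by rw [hDe]; simpa using hz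
    rw [Finset.mem_sdiff, hEe] at this
    simpa using this
  have hEm : ∀ z, z = u ∨ z = v ∨ z = w → z ∈ S := by
    intro z hz
    apply hES
    rw [hEe]
    simpa using hz
  have hin : ∀ z, z = p ∨ z = q → Inside z u v w := by
    intro z hz
    obtain ⟨hzS, hzu, hzv, hzw⟩ := hD z hz
    refine hP.inside_of_mem_convexHull (hSP hzS) (hSP (hEm u (by tauto))) (hSP (hEm v (by tauto)))
      (hSP (hEm w (by tauto))) huv huw hvw hzu.symm hzv.symm hzw.symm ?_
    have := subset_convexHull ℝ (S : Set (ℝ × ℝ)) hzS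
    rw [← hull, hEe] at this
    simpa using this
  have hSe : ∀ z, z ∈ S ↔ z ∈ [p, q, u, v, w] := by
    intro z
    rw [← Finset.sdiff_union_of_subset hES, hDe, hEe]
    simp
    tauto
  have hp := hD p (by tauto)
  have hq := hD q (by tauto)
  obtain ⟨a, b, c, x, y, hc, hz⟩ := exists_betaConfig hP (p := p) (q := q) (u := u) (v := v)
    (w := w) (by simp; tauto) (fun z hz => hSP ((hSe z).mpr hz)) (hin p (by tauto))
    (hin q (by tauto))
  refine ⟨a, b, c, x, y, hc, ?_⟩
  ext z
  rw [hSe, ← hz]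
  simp

lemma hullCount_eq_card_image (P : Finset (ℝ × ℝ)) (k j : ℕ) [DecidableEq (Set (ℝ × ℝ))]
    [DecidablePred fun S : Set (ℝ × ℝ) => (Set.extremePoints ℝ (convexHull ℝ S)).ncard = j] :
    hullCount P k j =
      (((P.powersetCard k).image fun S : Finset (ℝ × ℝ) => (S : Set (ℝ × ℝ))).filter
      fun S => (Set.extremePoints ℝ (convexHull ℝ S)).ncard = j).card := by
  unfold hullCount
  congr 1
  ext S
  simp only [Finset.mem_filter, Finset.bind_def, Finset.pure_def, Finset.mem_sup,
    Finset.mem_singleton, Finset.mem_image, eq_comm (a := S)]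

/-- The sum over 3-element subsets `T` of `P` of the number of pairs of β-points of `T`
lying in distinct regions with respect to `T` equals `T₂(P)`. -/
theorem sum_beta_diff_region_pairs (P : Finset (ℝ × ℝ)) (n : ℕ) (hgp : GenPos P)
    (hcard : P.card = n) :
    ∑ T ∈ P.powersetCard 3, betaDiffPairs P T = hullCount P 5 3 := by
  classical
  rw [hullCount_eq_card_image]
  unfold betaDiffPairs
  rw [← Finset.card_sigma]
  have hmem : ∀ A : (_ : Finset (ℝ × ℝ)) × Finset (ℝ × ℝ),
      A ∈ (P.powersetCard 3).sigma (fun T => ((P \ T).powersetCard 2).filter fun S =>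
        (∀ x ∈ S, IsBetaPt T x) ∧ ∀ x ∈ S, ∀ y ∈ S, x ≠ y → ¬ SameRegion T x y) ↔
      ∃ a b c x y, A = ⟨{a, b, c}, {x, y}⟩ ∧ BetaConfig P a b c x y := by
    rintro ⟨T, U⟩
    simp only [Finset.mem_sigma, Finset.mem_filter]
    constructor
    · rintro ⟨hT, hU, h⟩
      obtain ⟨a, b, c, x, y, rfl, rfl, h'⟩ := (betaDiff_iff hgp hT hU).mp h
      exact ⟨a, b, c, x, y, rfl, h'⟩
    · rintro ⟨a, b, c, x, y, hA, h⟩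
      obtain ⟨rfl, hU⟩ := Sigma.mk.inj hA
      obtain rfl := eq_of_heq hU
      have hn := h.nodup
      have hm := h.mem
      simp only [List.nodup_cons, List.mem_cons, List.not_mem_nil, or_false, not_or] at hn hm
      have hT : ({a, b, c} : Finset (ℝ × ℝ)) ∈ P.powersetCard 3 := by
        rw [Finset.mem_powersetCard, Finset.card_eq_three]
        refine ⟨fun z hz => hm z ?_, a, b, c, by tauto, by tauto, by tauto, rfl⟩
        simp at hz
        tauto
      have hU : ({x, y} : Finset (ℝ × ℝ)) ∈ (P \ {a, b, c}).powersetCard 2 := by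
        rw [Finset.mem_powersetCard, Finset.card_eq_two]
        refine ⟨fun z hz => Finset.mem_sdiff.mpr ⟨hm z ?_, ?_⟩, x, y, by tauto, rfl⟩
        · simp at hz
          tauto
        · simp at hz ⊢
          grind
      exact ⟨hT, hU, (betaDiff_iff hgp hT hU).mpr ⟨a, b, c, x, y, rfl, rfl, h⟩⟩
  have hunion : ∀ a b c x y : ℝ × ℝ,
      ({a, b, c} : Finset (ℝ × ℝ)) ∪ {x, y} = {a, b, c, x, y} := by
    intros
    ext
    simp
    tauto
  refine Finset.card_bij (fun A _ => ((A.1 ∪ A.2 : Finset (ℝ × ℝ)) : Set (ℝ × ℝ))) ?_ ?_ ?_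
  · intro A hA
    obtain ⟨a, b, c, x, y, rfl, h⟩ := (hmem A).mp hA
    have hn := h.nodup
    simp only [hunion]
    rw [Finset.mem_filter, h.extremePoints hgp rfl]
    refine ⟨Finset.mem_image.mpr ⟨{a, b, c, x, y}, Finset.mem_powersetCard.mpr
      ⟨fun z hz => h.mem z (by simpa using hz), ?_⟩, rfl⟩, ?_⟩
    · simpa using List.toFinset_card_of_nodup hn
    · rw [Set.ncard_eq_three]
      simp only [List.nodup_cons, List.mem_cons, List.not_mem_nil, or_false, not_or] at hn
      exact ⟨x, y, c, by tauto, by tauto, by tauto, rfl⟩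
  · intro A hA B hB hAB
    obtain ⟨a, b, c, x, y, rfl, h⟩ := (hmem A).mp hA
    obtain ⟨a', b', c', x', y', rfl, h'⟩ := (hmem B).mp hB
    simp only [hunion] at hAB
    obtain ⟨h1, h2⟩ := h.unique hgp h' (Finset.coe_injective hAB)
    rw [h1, h2]
  · intro S hS
    obtain ⟨hS, h⟩ := Finset.mem_filter.mp hS
    obtain ⟨S, hSP, rfl⟩ := Finset.mem_image.mp hS
    obtain ⟨a, b, c, x, y, hc, rfl⟩ := exists_betaConfig_of_ncard_extremePoints hgp hSP h
    exact ⟨⟨{a, b, c}, {x, y}⟩, (hmem _).mpr ⟨a, b, c, x, y, rfl, hc⟩,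
      by simp only [hunion]⟩
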